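/- Meet-or-avoid lemma: Let C be a nonempty closed subset of Cantor space, let F : (ℕ → Bool) → (ℕ → Bool) be continuous with F '' C ⊆ C, and let U ⊆ (ℕ → Bool) be open. Then either (1) there exists a nonempty closed set D ⊆ C with F '' D ⊆ D and D ∩ U = ∅, or (2) there exist b ∈ ℕ, a locally constant function j : (ℕ → Bool) → ℕ with 1 ≤ j x ≤ b for all x, and a clopen set V ⊆ U, such that for every x ∈ C one has F^[j x] x ∈ C ∩ V; in particular C ∩ V is a nonempty closed subset of C contained in U and invariant under the map x ↦ F^[j x] x. -/

import Mathlib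

/-- Meet-or-avoid lemma on Cantor space: either there is a nonempty closed
invariant subset of `C` avoiding `U`, or there is a piecewise combination of
iterates of `F` (with locally constant exponent bounded by some `b`) sending
every point of `C` into `C ∩ V` for some clopen `V ⊆ U`. -/
theorem meet_or_avoid (C : Set (ℕ → Bool)) (hCne : C.Nonempty)
    (hCcl : IsClosed C) (F : (ℕ → Bool) → (ℕ → Bool)) (hF : Continuous F)
    (hFC : F '' C ⊆ C) (U : Set (ℕ → Bool)) (hU : IsOpen U) :
    (∃ D : Set (ℕ → Bool), D.Nonempty ∧ IsClosed D ∧ D ⊆ C ∧ F '' D ⊆ D ∧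
      D ∩ U = ∅) ∨
    (∃ (b : ℕ) (j : (ℕ → Bool) → ℕ) (V : Set (ℕ → Bool)),
      IsLocallyConstant j ∧ (∀ x, 1 ≤ j x ∧ j x ≤ b) ∧ IsClopen V ∧ V ⊆ U ∧
      ∀ x ∈ C, F^[j x] x ∈ C ∩ V) := by
  rcases em (∃ x ∈ C, ∀ n, 1 ≤ n → F^[n] x ∉ U) with ⟨x, hxC, hx⟩ | havoid
  · left
    refine ⟨C ∩ ⋂ n, F^[n] ⁻¹' Uᶜ, ⟨F x, hFC ⟨x, hxC, rfl⟩, ?_⟩, ?_, Set.inter_subset_left, ?_, ?_⟩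
    · exact Set.mem_iInter.2 fun n => hx (n + 1) (Nat.le_add_left 1 n)
    · exact hCcl.inter (isClosed_iInter fun n => hU.isClosed_compl.preimage (hF.iterate n))
    · rintro _ ⟨y, ⟨hyC, hy⟩, rfl⟩
      exact ⟨hFC ⟨y, hyC, rfl⟩, Set.mem_iInter.2 fun n => Set.mem_iInter.1 hy (n + 1)⟩
    · ext y
      simp only [Set.mem_inter_iff, Set.mem_empty_iff_false, iff_false, not_and]
      exact fun hy => Set.mem_iInter.1 hy.2 0
  · right
    push Not at havoid
    have hloc : ∀ x : C, ∃ (n : ℕ) (V : Set (ℕ → Bool)),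
        1 ≤ n ∧ IsClopen V ∧ V ⊆ U ∧ F^[n] x ∈ V := by
      rintro ⟨x, hx⟩
      obtain ⟨n, hn, hnU⟩ := havoid x hx
      obtain ⟨V, hV, hxV, hVU⟩ := compact_exists_isClopen_in_isOpen hU hnU
      exact ⟨n, V, hn, hV, hVU, hxV⟩
    choose n W hn hW hWU hxW using hloc
    obtain ⟨t, ht⟩ := hCcl.isCompact.elim_finite_subcover (fun x : C => F^[n x] ⁻¹' W x)
      (fun x => (hW x).isOpen.preimage (hF.iterate _))
      (fun x hx => Set.mem_iUnion.2 ⟨⟨x, hx⟩, hxW ⟨x, hx⟩⟩)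
    set V : Set (ℕ → Bool) := ⋃ x ∈ t, W x
    have hV : IsClopen V := t.finite_toSet.isClopen_biUnion fun x _ => hW x
    set b : ℕ := t.sup n + 1
    have hreach : ∀ x ∈ C, ∃ k, 1 ≤ k ∧ k ≤ b ∧ F^[k] x ∈ V := by
      intro x hx
      obtain ⟨z, hzt, hz⟩ := Set.mem_iUnion₂.1 (ht hx)
      exact ⟨n z, hn z, (Finset.le_sup hzt).trans (Nat.le_succ _), Set.mem_biUnion hzt hz⟩
    let S : (ℕ → Bool) → Set ℕ := fun x => {k | 1 ≤ k ∧ k ≤ b ∧ (F^[k] x ∈ V ∨ k = b)}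
    have hS : ∀ x, sInf (S x) ∈ S x := fun x =>
      Nat.sInf_mem ⟨b, Nat.le_add_left 1 _, le_rfl, Or.inr rfl⟩
    refine ⟨b, fun x => sInf (S x), V, ?_, fun x => ⟨(hS x).1, (hS x).2.1⟩, hV,
      Set.iUnion₂_subset fun x _ => hWU x, fun x hx => ⟨?_, ?_⟩⟩
    · rw [IsLocallyConstant.iff_eventually_eq]
      intro x
      have hev : ∀ k ∈ Finset.range (b + 1), ∀ᶠ y in nhds x, (F^[k] y ∈ V ↔ F^[k] x ∈ V) := by
        intro k _
        have hk : IsClopen (F^[k] ⁻¹' V) := hV.preimage (hF.iterate k)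
        by_cases h : F^[k] x ∈ V
        · filter_upwards [hk.isOpen.mem_nhds h] with y hy using iff_of_true hy h
        · filter_upwards [hk.compl.isOpen.mem_nhds h] with y hy using iff_of_false hy h
      filter_upwards [(Filter.eventually_all_finset _).2 hev] with y hy
      congr 1
      ext k
      refine and_congr_right fun _ => and_congr_right fun hkb => or_congr_left ?_
      exact hy k (Finset.mem_range.2 (Nat.lt_succ_of_le hkb))
    · exact (Set.mapsTo_iff_image_subset.2 hFC).iterate _ hx
    · obtain ⟨k, hk1, hkb, hkV⟩ := hreach x hx
      have hle : sInf (S x) ≤ k := Nat.sInf_le ⟨hk1, hkb, Or.inl hkV⟩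
      rcases (hS x).2.2 with h | h
      · exact h
      · have hkeq : sInf (S x) = k := le_antisymm hle (h ▸ hkb)
        simpa only [hkeq] using hkV
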